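/- Let p, q : ℕ → ℝ both satisfy the recurrence u(n) = 4n(68n² + 3)·u(n-1) - (2n-1)⁶·u(n-2) for all n ≥ 2, with initial values p(0) = 112, p(1) = 112·284 + 16 = 31824, q(0) = 1, q(1) = 284. Then q(n) ≠ 0 for all n and the sequence p(n)/q(n) converges to 112 + 16·I₃(1)/I₃(0), where I₃(0) = ∭_{[0,1]³} dx dy dz/√(x(1-x)y(1-y)z(1-z)(1-(1-xy)z)) and I₃(1) = ∭_{[0,1]³} (x(1-x)y(1-y)z(1-z))^{1/2}·(1-(1-xy)z)^{-3/2} dx dy dz. -/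

import Mathlib

open MeasureTheory Filter

/-- `I₃(0) = ∭_{[0,1]³} dx dy dz/√(x(1-x)y(1-y)z(1-z)(1-(1-xy)z))`. -/
noncomputable def I₃zero : ℝ :=
  ∫ p in Set.Ioo (0 : ℝ) 1 ×ˢ Set.Ioo (0 : ℝ) 1 ×ˢ Set.Ioo (0 : ℝ) 1,
    1 / Real.sqrt (p.1 * (1 - p.1) * p.2.1 * (1 - p.2.1) * p.2.2 * (1 - p.2.2) *
      (1 - (1 - p.1 * p.2.1) * p.2.2))

/-- `I₃(1) = ∭_{[0,1]³} (x(1-x)y(1-y)z(1-z))^{1/2}·(1-(1-xy)z)^{-3/2} dx dy dz`. -/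
noncomputable def I₃one : ℝ :=
  ∫ p in Set.Ioo (0 : ℝ) 1 ×ˢ Set.Ioo (0 : ℝ) 1 ×ˢ Set.Ioo (0 : ℝ) 1,
    (p.1 * (1 - p.1) * p.2.1 * (1 - p.2.1) * p.2.2 * (1 - p.2.2)) ^ ((1 : ℝ) / 2) *
      (1 - (1 - p.1 * p.2.1) * p.2.2) ^ (-(3 : ℝ) / 2)

/-! ### The integrands -/

/-- The polynomial `1 - (1 - xy)z`. -/
noncomputable def aperyDenom (p : ℝ × ℝ × ℝ) : ℝ := 1 - (1 - p.1 * p.2.1) * p.2.2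

/-- The polynomial `x(1-x)y(1-y)z(1-z)`. -/
noncomputable def aperyNumer (p : ℝ × ℝ × ℝ) : ℝ :=
  p.1 * (1 - p.1) * p.2.1 * (1 - p.2.1) * p.2.2 * (1 - p.2.2)

/-- The integrand `(x(1-x)y(1-y)z(1-z))^(m-1/2) / (1-(1-xy)z)^(m+1/2)`. -/
noncomputable def aperyWeight (m : ℕ) (p : ℝ × ℝ × ℝ) : ℝ :=
  (aperyNumer p / aperyDenom p) ^ m * (1 / Real.sqrt (aperyNumer p * aperyDenom p))

/-- The bounded function `(1-z)/(1-(1-xy)z)`, in terms of which `xyz/(1-(1-xy)z)` is `1` minus it. -/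
noncomputable def aperyRatio (p : ℝ × ℝ × ℝ) : ℝ := (1 - p.2.2) / aperyDenom p

/-- Lebesgue measure on the unit interval. -/
noncomputable def unitMeasure : Measure ℝ := volume.restrict (Set.Ioo (0 : ℝ) 1)

/-- Lebesgue measure on the unit cube. -/
noncomputable def cubeMeasure : Measure (ℝ × ℝ × ℝ) :=
  unitMeasure.prod (unitMeasure.prod unitMeasure)

/-- The integral `I₃(m)`. -/
noncomputable def aperyIntegral (m : ℕ) : ℝ := ∫ p, aperyWeight m p ∂cubeMeasure

instance : IsFiniteMeasure unitMeasure := by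
  unfold unitMeasure
  infer_instance

lemma cubeMeasure_eq_restrict : cubeMeasure =
    volume.restrict (Set.Ioo (0 : ℝ) 1 ×ˢ Set.Ioo (0 : ℝ) 1 ×ˢ Set.Ioo (0 : ℝ) 1) := by
  simp only [cubeMeasure, unitMeasure, Measure.volume_eq_prod, Measure.prod_restrict]

lemma measurableSet_cube :
    MeasurableSet (Set.Ioo (0 : ℝ) 1 ×ˢ Set.Ioo (0 : ℝ) 1 ×ˢ Set.Ioo (0 : ℝ) 1) :=
  measurableSet_Ioo.prod (measurableSet_Ioo.prod measurableSet_Ioo)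

lemma ae_cubeMeasure {P : ℝ × ℝ × ℝ → Prop}
    (h : ∀ x ∈ Set.Ioo (0 : ℝ) 1, ∀ y ∈ Set.Ioo (0 : ℝ) 1, ∀ z ∈ Set.Ioo (0 : ℝ) 1, P (x, y, z)) :
    ∀ᵐ p ∂cubeMeasure, P p := by
  rw [cubeMeasure_eq_restrict]
  refine ae_restrict_of_forall_mem measurableSet_cube ?_
  rintro ⟨x, y, z⟩ ⟨hx, hy, hz⟩
  exact h x hx y hy z hz

lemma measurable_aperyDenom : Measurable aperyDenom := by
  unfold aperyDenom
  fun_prop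

lemma measurable_aperyNumer : Measurable aperyNumer := by
  unfold aperyNumer
  fun_prop

lemma measurable_aperyWeight (m : ℕ) : Measurable (aperyWeight m) := by
  have := measurable_aperyDenom
  have := measurable_aperyNumer
  unfold aperyWeight
  fun_prop

lemma measurable_aperyRatio : Measurable aperyRatio := by
  have := measurable_aperyDenom
  unfold aperyRatio
  fun_prop

lemma aperyDenom_eq_add (x y z : ℝ) : aperyDenom (x, y, z) = (1 - z) + x * y * z := by
  simp only [aperyDenom]
  ring

lemma aperyDenom_pos {x y z : ℝ} (hx : x ∈ Set.Ioo (0 : ℝ) 1) (hy : y ∈ Set.Ioo (0 : ℝ) 1)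
    (hz : z ∈ Set.Ioo (0 : ℝ) 1) : 0 < aperyDenom (x, y, z) := by
  have h1 : 0 < 1 - z := sub_pos.2 hz.2
  have h2 : 0 < x * y * z := mul_pos (mul_pos hx.1 hy.1) hz.1
  rw [aperyDenom_eq_add]
  positivity

lemma aperyNumer_pos {x y z : ℝ} (hx : x ∈ Set.Ioo (0 : ℝ) 1) (hy : y ∈ Set.Ioo (0 : ℝ) 1)
    (hz : z ∈ Set.Ioo (0 : ℝ) 1) : 0 < aperyNumer (x, y, z) := by
  have h1 : 0 < 1 - x := sub_pos.2 hx.2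
  have h2 : 0 < 1 - y := sub_pos.2 hy.2
  have h3 : 0 < 1 - z := sub_pos.2 hz.2
  have h4 := hx.1
  have h5 := hy.1
  have h6 := hz.1
  simp only [aperyNumer]
  positivity

lemma aperyWeight_pos (m : ℕ) {x y z : ℝ} (hx : x ∈ Set.Ioo (0 : ℝ) 1)
    (hy : y ∈ Set.Ioo (0 : ℝ) 1) (hz : z ∈ Set.Ioo (0 : ℝ) 1) : 0 < aperyWeight m (x, y, z) := by
  have h1 := aperyDenom_pos hx hy hz
  have h2 := aperyNumer_pos hx hy hz
  unfold aperyWeight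
  positivity

lemma aperyNumer_div_le {x y z : ℝ} (hx : x ∈ Set.Ioo (0 : ℝ) 1) (hy : y ∈ Set.Ioo (0 : ℝ) 1)
    (hz : z ∈ Set.Ioo (0 : ℝ) 1) : aperyNumer (x, y, z) / aperyDenom (x, y, z) ≤ 1 / 2 := by
  rw [div_le_iff₀ (aperyDenom_pos hx hy hz), aperyDenom_eq_add]
  have hx' : x * (1 - x) ≤ 1 / 2 := by nlinarith [sq_nonneg (x - 1 / 2)]
  have hy' : y * (1 - y) ≤ 1 := by nlinarith [sq_nonneg (y - 1 / 2)]
  have h1 : 0 < 1 - z := sub_pos.2 hz.2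
  have h2 : 0 < x * y * z := mul_pos (mul_pos hx.1 hy.1) hz.1
  have h3 : 0 < y * (1 - y) := mul_pos hy.1 (sub_pos.2 hy.2)
  calc aperyNumer (x, y, z) = (x * (1 - x)) * (y * (1 - y)) * z * (1 - z) := by
        simp only [aperyNumer]
        ring
    _ ≤ 1 / 2 * 1 * 1 * (1 - z) := by
        gcongr
        · exact hz.1.le
        · exact hz.2.le
    _ ≤ 1 / 2 * (1 - z + x * y * z) := by linarith

lemma sqrt_aperyNumer_le {x y z : ℝ} (hx : x ∈ Set.Ioo (0 : ℝ) 1) (hy : y ∈ Set.Ioo (0 : ℝ) 1)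
    (hz : z ∈ Set.Ioo (0 : ℝ) 1) :
    Real.sqrt (aperyNumer (x, y, z)) ≤ aperyDenom (x, y, z) := by
  refine Real.sqrt_le_iff.2 ⟨(aperyDenom_pos hx hy hz).le, ?_⟩
  have h1 : 0 < 1 - z := sub_pos.2 hz.2
  have h2 : 0 < x * y * z := mul_pos (mul_pos hx.1 hy.1) hz.1
  have h3 : (1 - x) * (1 - y) ≤ 1 :=
    mul_le_one₀ (by linarith [hx.1]) (sub_nonneg.2 hy.2.le) (by linarith [hy.1])
  calc aperyNumer (x, y, z) = (x * y * z) * (1 - z) * ((1 - x) * (1 - y)) := by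
        simp only [aperyNumer]
        ring
    _ ≤ (x * y * z) * (1 - z) * 1 := by gcongr
    _ ≤ aperyDenom (x, y, z) ^ 2 := by
        rw [aperyDenom_eq_add]
        nlinarith

lemma aperyRatio_mem {x y z : ℝ} (hx : x ∈ Set.Ioo (0 : ℝ) 1) (hy : y ∈ Set.Ioo (0 : ℝ) 1)
    (hz : z ∈ Set.Ioo (0 : ℝ) 1) : aperyRatio (x, y, z) ∈ Set.Icc (0 : ℝ) 1 := by
  have h1 : 0 ≤ 1 - z := sub_nonneg.2 hz.2.le
  have h2 : 0 < x * y * z := mul_pos (mul_pos hx.1 hy.1) hz.1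
  have h3 := aperyDenom_pos hx hy hz
  refine ⟨div_nonneg h1 h3.le, div_le_one_of_le₀ ?_ h3.le⟩
  rw [aperyDenom_eq_add]
  simp only
  linarith

/-! ### Integrability -/

lemma integrable_rpow_mul_one_sub :
    Integrable (fun t : ℝ => (t * (1 - t)) ^ (-(3 / 4) : ℝ)) unitMeasure := by
  have h := Complex.betaIntegral_convergent (u := (1 / 4 : ℝ)) (v := (1 / 4 : ℝ))
    (by rw [Complex.ofReal_re]; norm_num) (by rw [Complex.ofReal_re]; norm_num)
  rw [intervalIntegrable_iff_integrableOn_Ioo_of_le zero_le_one] at h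
  refine h.norm.congr (ae_restrict_of_forall_mem measurableSet_Ioo fun t ht => ?_)
  have h1 : 0 < 1 - t := sub_pos.2 ht.2
  beta_reduce
  rw [Real.mul_rpow ht.1.le h1.le, norm_mul]
  have e : ((1 / 4 : ℝ) : ℂ) - 1 = ((-(3 / 4) : ℝ) : ℂ) := by
    push_cast
    norm_num
  rw [e, ← Complex.ofReal_one, ← Complex.ofReal_sub,
    ← Complex.ofReal_cpow ht.1.le, ← Complex.ofReal_cpow h1.le, Complex.norm_real,
    Complex.norm_real, Real.norm_of_nonneg (Real.rpow_nonneg ht.1.le _),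
    Real.norm_of_nonneg (Real.rpow_nonneg h1.le _)]

lemma one_div_sqrt_le {u d : ℝ} (hu : 0 < u) (hd : Real.sqrt u ≤ d) :
    1 / Real.sqrt (u * d) ≤ u ^ (-(3 / 4) : ℝ) := by
  rw [Real.rpow_neg hu.le, ← one_div]
  refine one_div_le_one_div_of_le (Real.rpow_pos_of_pos hu _) (Real.le_sqrt_of_sq_le ?_)
  rw [← Real.rpow_natCast, ← Real.rpow_mul hu.le]
  calc u ^ ((3 / 4 : ℝ) * (2 : ℕ)) = u ^ (1 + 1 / 2 : ℝ) := by norm_num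
    _ = u * Real.sqrt u := by rw [Real.rpow_add hu, Real.rpow_one, Real.sqrt_eq_rpow]
    _ ≤ u * d := by gcongr

lemma integrable_aperyWeight_zero : Integrable (aperyWeight 0) cubeMeasure := by
  have h := integrable_rpow_mul_one_sub
  refine (h.mul_prod (h.mul_prod h)).mono' (measurable_aperyWeight 0).aestronglyMeasurable
    (ae_cubeMeasure fun x hx y hy z hz => ?_)
  rw [Real.norm_of_nonneg (aperyWeight_pos 0 hx hy hz).le]
  have hx' : 0 ≤ x * (1 - x) := mul_nonneg hx.1.le (sub_nonneg.2 hx.2.le)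
  have hy' : 0 ≤ y * (1 - y) := mul_nonneg hy.1.le (sub_nonneg.2 hy.2.le)
  have hz' : 0 ≤ z * (1 - z) := mul_nonneg hz.1.le (sub_nonneg.2 hz.2.le)
  calc aperyWeight 0 (x, y, z)
      = 1 / Real.sqrt (aperyNumer (x, y, z) * aperyDenom (x, y, z)) := by simp [aperyWeight]
    _ ≤ aperyNumer (x, y, z) ^ (-(3 / 4) : ℝ) :=
        one_div_sqrt_le (aperyNumer_pos hx hy hz) (sqrt_aperyNumer_le hx hy hz)
    _ = _ := by
        rw [← Real.mul_rpow hy' hz', ← Real.mul_rpow hx' (mul_nonneg hy' hz')]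
        congr 1
        simp only [aperyNumer]
        ring

lemma aperyWeight_le (m : ℕ) {x y z : ℝ} (hx : x ∈ Set.Ioo (0 : ℝ) 1)
    (hy : y ∈ Set.Ioo (0 : ℝ) 1) (hz : z ∈ Set.Ioo (0 : ℝ) 1) :
    aperyWeight m (x, y, z) ≤ (1 / 2) ^ m * aperyWeight 0 (x, y, z) := by
  have h1 := aperyDenom_pos hx hy hz
  have h2 := aperyNumer_pos hx hy hz
  have h3 := aperyNumer_div_le hx hy hz
  simp only [aperyWeight, pow_zero, one_mul]
  gcongr

/-- The weight times a continuous function of `x, y, z` and the ratio is integrable. -/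
lemma integrable_aperyWeight_mul (m : ℕ) {g : ℝ × ℝ × ℝ × ℝ → ℝ} (hg : Continuous g) :
    Integrable (fun p => aperyWeight m p * g (p.1, p.2.1, p.2.2, aperyRatio p)) cubeMeasure := by
  have hK : IsCompact (Set.Icc (0 : ℝ) 1 ×ˢ Set.Icc (0 : ℝ) 1 ×ˢ Set.Icc (0 : ℝ) 1 ×ˢ
      Set.Icc (0 : ℝ) 1) :=
    isCompact_Icc.prod (isCompact_Icc.prod (isCompact_Icc.prod isCompact_Icc))
  obtain ⟨C, hC⟩ := hK.exists_bound_of_continuousOn hg.continuousOn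
  have hmeas : Measurable fun p : ℝ × ℝ × ℝ => g (p.1, p.2.1, p.2.2, aperyRatio p) := by
    have := measurable_aperyRatio
    have := hg.measurable
    fun_prop
  have hw : Integrable (aperyWeight m) cubeMeasure := by
    refine (integrable_aperyWeight_zero.const_mul ((1 / 2) ^ m)).mono'
      (measurable_aperyWeight m).aestronglyMeasurable (ae_cubeMeasure fun x hx y hy z hz => ?_)
    rw [Real.norm_of_nonneg (aperyWeight_pos m hx hy hz).le]
    exact aperyWeight_le m hx hy hz
  refine hw.mul_bdd (c := C) hmeas.aestronglyMeasurable (ae_cubeMeasure fun x hx y hy z hz => ?_)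
  exact hC _ ⟨Set.Ioo_subset_Icc_self hx, Set.Ioo_subset_Icc_self hy, Set.Ioo_subset_Icc_self hz,
    aperyRatio_mem hx hy hz⟩

lemma integrable_aperyWeight (m : ℕ) : Integrable (aperyWeight m) cubeMeasure := by
  simpa using integrable_aperyWeight_mul m (g := fun _ => 1) continuous_const

/-! ### Integration along one coordinate -/

lemma hasDerivAt_pow_of_logDeriv {f : ℝ → ℝ} {g t : ℝ} (m : ℕ) (h : HasDerivAt f (f t * g) t) :
    HasDerivAt (fun s => f s ^ m) (f t ^ m * (m * g)) t := by
  convert! h.fun_pow m using 1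
  cases m with
  | zero => simp
  | succ m =>
    simp only [Nat.add_sub_cancel]
    ring

/-- The derivative of `t(1-t) a(t) F(t)`, where
`F(t) = (t(1-t)K/E(t))^m / √(t(1-t)K E(t))`, integrates to zero over the unit interval. -/
lemma integral_deriv_mul_weight_eq_zero (m : ℕ) {K : ℝ} (hK : 0 < K) {E E' a a' : ℝ → ℝ}
    (hE : ∀ t ∈ Set.Icc (0 : ℝ) 1, HasDerivAt E (E' t) t)
    (hEpos : ∀ t ∈ Set.Icc (0 : ℝ) 1, 0 < E t)
    (ha : ∀ t ∈ Set.Icc (0 : ℝ) 1, HasDerivAt a (a' t) t) :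
    ∫ t, (t * (1 - t) * K / E t) ^ m * (1 / Real.sqrt (t * (1 - t) * K * E t)) *
      ((m + 1 / 2) * ((1 - 2 * t) - t * (1 - t) * E' t / E t) * a t + t * (1 - t) * a' t)
      ∂unitMeasure = 0 := by
  set f' : ℝ → ℝ := fun t => (t * (1 - t) * K / E t) ^ m *
    (1 / Real.sqrt (t * (1 - t) * K * E t)) *
      ((m + 1 / 2) * ((1 - 2 * t) - t * (1 - t) * E' t / E t) * a t + t * (1 - t) * a' t)
  let f : ℝ → ℝ := fun t => Real.sqrt (t * (1 - t)) *
    ((t * (1 - t) * K / E t) ^ m / Real.sqrt (K * E t) * a t)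
  have hEc : ContinuousOn E (Set.Icc 0 1) := fun t ht => (hE t ht).continuousAt.continuousWithinAt
  have hac : ContinuousOn a (Set.Icc 0 1) := fun t ht => (ha t ht).continuousAt.continuousWithinAt
  have hf : ContinuousOn f (Set.Icc 0 1) := by
    have h1 : ∀ t ∈ Set.Icc (0 : ℝ) 1, E t ≠ 0 := fun t ht => (hEpos t ht).ne'
    have h2 : ∀ t ∈ Set.Icc (0 : ℝ) 1, Real.sqrt (K * E t) ≠ 0 := fun t ht =>
      (Real.sqrt_pos.2 (mul_pos hK (hEpos t ht))).ne'
    fun_prop (disch := assumption)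
  have hderiv : ∀ t ∈ Set.Ioo (0 : ℝ) 1, HasDerivAt f (f' t) t := by
    intro t ht
    have htI := Set.Ioo_subset_Icc_self ht
    have hEt := hEpos t htI
    have h1 : 0 < 1 - t := sub_pos.2 ht.2
    have h0 := ht.1
    have hw0 : 0 < t * (1 - t) := mul_pos h0 h1
    have hw : HasDerivAt (fun s : ℝ => s * (1 - s)) (1 - 2 * t) t := by
      convert! (hasDerivAt_id t).mul ((hasDerivAt_id t).const_sub 1) using 1
      simp only [id]
      ring
    have hq : HasDerivAt (fun s => Real.sqrt (K * E s))
        (K * E' t / (2 * Real.sqrt (K * E t))) t :=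
      ((hE t htI).const_mul K).sqrt (mul_pos hK hEt).ne'
    have hW : HasDerivAt (fun s => s * (1 - s) * K / E s)
        (t * (1 - t) * K / E t * ((1 - 2 * t) / (t * (1 - t)) - E' t / E t)) t := by
      convert! (hw.mul_const K).fun_div (hE t htI) hEt.ne' using 1
      field_simp
    have hs2 := Real.sq_sqrt hw0.le
    have hq2 := Real.sq_sqrt (mul_pos hK hEt).le
    have hs0 := Real.sqrt_pos.2 hw0
    have hq0 := Real.sqrt_pos.2 (mul_pos hK hEt)
    convert! (hw.sqrt hw0.ne').fun_mul
      (((hasDerivAt_pow_of_logDeriv m hW).fun_div hq hq0.ne').fun_mul (ha t htI)) using 1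
    simp only [f', mul_assoc (t * (1 - t)) K (E t), Real.sqrt_mul hw0.le]
    generalize (t * (1 - t) * K / E t) ^ m = A
    have hKE : K * E' t = Real.sqrt (K * E t) ^ 2 / E t * E' t := by rw [hq2]; field_simp
    rw [hKE]
    field_simp
    rw [hs2]
    ring
  by_cases hint : IntervalIntegrable f' volume 0 1
  · have h := intervalIntegral.integral_eq_sub_of_hasDerivAt_of_le zero_le_one hf hderiv hint
    rw [intervalIntegral.integral_of_le zero_le_one, integral_Ioc_eq_integral_Ioo] at h
    simpa [f, unitMeasure] using h
  · rw [intervalIntegrable_iff_integrableOn_Ioo_of_le zero_le_one] at hint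
    exact integral_undef hint

/-! ### The creative-telescoping certificate -/

/-- The polynomial part of the certificate in the direction of `x`, divided by `x`. -/
noncomputable def certX₀ (k y z : ℝ) : ℝ := -(2 * k + 1) ^ 2 * y ^ 2 * (1 - z) ^ 2

/-- The coefficients, in powers of `x`, of the part of the certificate in the direction of `x`
that multiplies the ratio `(1-z)/(1-(1-xy)z)`. -/
noncomputable def certX₁ (k y z : ℝ) : Fin 3 → ℝ :=
  ![3 * (2 * k - 1) ^ 2 - 2 * (2 * k - 1) ^ 2 * z + (28 * k ^ 2 - 32 * k + 1) * y
      - (20 * k ^ 2 - 20 * k + 1) * y * z + (32 * k ^ 2 + 8 * k - 4) * y ^ 2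
      - (64 * k ^ 2 + 28 * k + 2) * y ^ 2 * z + (32 * k ^ 2 + 28 * k + 6) * y ^ 2 * z ^ 2,
    (4 * k - 2) - (68 * k ^ 2 - 36 * k + 1) * y - (40 * k ^ 2 + 24 * k - 2) * y * z
      + (12 * k ^ 2 + 4 * k - 1) * y ^ 2 + (80 * k ^ 2 + 4 * k + 2) * y ^ 2 * z
      - (40 * k ^ 2 + 36 * k + 8) * y ^ 2 * z ^ 2,
    -2 * (2 * k + 1) ^ 2 * y * z + (24 * k ^ 2 + 20 * k + 4) * y * z ^ 2
      + (16 * k ^ 2 + 12 * k + 2) * y ^ 2 * z * (1 - z)]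

/-- The coefficients, in powers of `z`, of the polynomial part of the certificate in the direction
of `z`. -/
noncomputable def certZ₀ (k x y : ℝ) : Fin 2 → ℝ :=
  ![-2 * (2 * k - 1) ^ 2 - (16 * k ^ 2 + 12 * k + 2) * (x ^ 2 + y ^ 2),
    (16 * k ^ 2 + 12 * k + 2) * (x ^ 2 + y ^ 2)]

/-- The coefficients, in powers of `z`, of the part of the certificate in the direction of `z`
that multiplies the ratio `(1-z)/(1-(1-xy)z)`. -/
noncomputable def certZ₁ (k x y : ℝ) : Fin 2 → ℝ :=
  ![-2 * (2 * k - 1) ^ 2 - (4 * k ^ 2 - 4 * k - 3) * (x + y) + (248 * k ^ 2 - 64 * k + 2) * (x * y)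
      - (16 * k ^ 2 - 12 * k - 6) * (x ^ 2 + y ^ 2)
      - (80 * k ^ 2 - 12 * k + 10) * (x * y * (x + y)) + 16 * k * (2 * k + 1) * (x ^ 2 * y ^ 2),
    (16 * k ^ 2 - 16 * k - 8) * (x ^ 2 + y ^ 2) - (84 * k ^ 2 - 12 * k - 15) * (x * y * (x + y))
      + (136 * k ^ 2 + 8 * k - 14) * (x ^ 2 * y ^ 2)]

/-- The divergence contributed by the direction of `x`, relative to the weight, as a polynomial in
`x, y, z` and the ratio `r`. -/
noncomputable def divX (k x y z r : ℝ) : ℝ :=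
  (k - 1 / 2) * ((1 - 2 * x) - (1 - x) * (1 - r)) *
      (certX₀ k y z * x + (certX₁ k y z 0 + certX₁ k y z 1 * x + certX₁ k y z 2 * x ^ 2) * r)
    + x * (1 - x) * (certX₀ k y z + (certX₁ k y z 1 + 2 * certX₁ k y z 2 * x) * r)
    - (certX₁ k y z 0 + certX₁ k y z 1 * x + certX₁ k y z 2 * x ^ 2) * ((1 - x) * r * (1 - r))

/-- The divergence contributed by the direction of `z`, relative to the weight, as a polynomial in
`x, y, z` and the ratio `r`. -/
noncomputable def divZ (k x y z r : ℝ) : ℝ :=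
  (k - 1 / 2) * ((1 - 2 * z) + z * r * (1 - x * y)) *
      (certZ₀ k x y 0 + certZ₀ k x y 1 * z + (certZ₁ k x y 0 + certZ₁ k x y 1 * z) * r)
    + z * (1 - z) * (certZ₀ k x y 1 + certZ₁ k x y 1 * r)
    + (certZ₁ k x y 0 + certZ₁ k x y 1 * z) * (z * (r ^ 2 * (1 - x * y) - r))

set_option maxRecDepth 4000 in
lemma divX_add_divX_add_divZ {k x y z d : ℝ} (hd : d = 1 - z + x * y * z) (h : d ≠ 0) :
    divX k x y z ((1 - z) / d) + divX k y x z ((1 - z) / d) + divZ k x y z ((1 - z) / d) =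
      (2 * k + 1) ^ 3 * (x * (1 - x) * y * (1 - y) * z * ((1 - z) / d)) ^ 2
        - 4 * k * (68 * k ^ 2 + 3) * (x * (1 - x) * y * (1 - y) * z * ((1 - z) / d))
        + (2 * k - 1) ^ 3 := by
  simp only [divX, divZ, certX₀, certX₁, certZ₀, certZ₁, Matrix.cons_val]
  field_simp
  rw [hd]
  ring

lemma continuous_divX (k : ℝ) :
    Continuous fun v : ℝ × ℝ × ℝ × ℝ => divX k v.1 v.2.1 v.2.2.1 v.2.2.2 := by
  simp only [divX, certX₀, certX₁, Matrix.cons_val]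
  fun_prop

lemma continuous_divZ (k : ℝ) :
    Continuous fun v : ℝ × ℝ × ℝ × ℝ => divZ k v.1 v.2.1 v.2.2.1 v.2.2.2 := by
  simp only [divZ, certZ₀, certZ₁, Matrix.cons_val]
  fun_prop

lemma hasDerivAt_quadratic (a b c t : ℝ) :
    HasDerivAt (fun s : ℝ => a + b * s + c * s ^ 2) (b + 2 * c * t) t := by
  convert! (((hasDerivAt_id t).const_mul b).const_add a).fun_add
    (((hasDerivAt_id t).fun_pow 2).const_mul c) using 1
  simp only [id]
  ring

lemma hasDerivAt_linear (a b t : ℝ) : HasDerivAt (fun s : ℝ => a + b * s) b t := by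
  simpa using ((hasDerivAt_id t).const_mul b).const_add a

lemma integral_aperyWeight_mul_divX_slice (m : ℕ) {y z : ℝ} (hy : y ∈ Set.Ioo (0 : ℝ) 1)
    (hz : z ∈ Set.Ioo (0 : ℝ) 1) :
    ∫ x, aperyWeight m (x, y, z) * divX (m + 1) x y z (aperyRatio (x, y, z)) ∂unitMeasure = 0 := by
  have h1 : 0 < 1 - y := sub_pos.2 hy.2
  have h2 : 0 < 1 - z := sub_pos.2 hz.2
  have hy0 := hy.1
  have hz0 := hz.1
  have hE (t : ℝ) : HasDerivAt (fun t => aperyDenom (t, y, z)) (y * z) t := by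
    convert! hasDerivAt_linear (1 - z) (y * z) t using 1
    ext s
    simp only [aperyDenom]
    ring
  have hEpos : ∀ t ∈ Set.Icc (0 : ℝ) 1, 0 < aperyDenom (t, y, z) := by
    intro t ht
    have := ht.1
    rw [aperyDenom_eq_add]
    positivity
  set k : ℝ := m + 1
  have ha : ∀ t ∈ Set.Icc (0 : ℝ) 1, HasDerivAt
      (fun t => certX₀ k y z * t + (certX₁ k y z 0 + certX₁ k y z 1 * t + certX₁ k y z 2 * t ^ 2) *
        aperyRatio (t, y, z)) _ t := fun t ht =>
    ((hasDerivAt_id t).const_mul (certX₀ k y z)).fun_add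
      ((hasDerivAt_quadratic (certX₁ k y z 0) (certX₁ k y z 1) (certX₁ k y z 2) t).fun_mul
        ((hasDerivAt_const t (1 - z)).fun_div (hE t) (hEpos t ht).ne'))
  have hK : 0 < y * (1 - y) * z * (1 - z) := by positivity
  rw [← integral_deriv_mul_weight_eq_zero m hK (fun t _ => hE t) hEpos ha]
  refine integral_congr_ae (ae_restrict_of_forall_mem measurableSet_Ioo fun t ht => ?_)
  have hd := (hEpos t (Set.Ioo_subset_Icc_self ht)).ne'
  have hd' := aperyDenom_eq_add t y z
  have hr : 1 - aperyRatio (t, y, z) = t * y * z / aperyDenom (t, y, z) := by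
    simp only [aperyRatio]
    field_simp
    rw [hd']
    ring
  have hU : t * (1 - t) * (y * (1 - y) * z * (1 - z)) = aperyNumer (t, y, z) := by
    simp only [aperyNumer]
    ring
  have hk : (m : ℝ) + 1 / 2 = k - 1 / 2 := by
    simp only [k]
    ring
  simp only [hU, hk, divX, hr]
  rw [aperyWeight]
  congr 1
  simp only [aperyRatio]
  field_simp
  ring

lemma integral_aperyWeight_mul_divZ_slice (m : ℕ) {x y : ℝ} (hx : x ∈ Set.Ioo (0 : ℝ) 1)
    (hy : y ∈ Set.Ioo (0 : ℝ) 1) :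
    ∫ z, aperyWeight m (x, y, z) * divZ (m + 1) x y z (aperyRatio (x, y, z)) ∂unitMeasure = 0 := by
  have h1 : 0 < 1 - y := sub_pos.2 hy.2
  have h2 : 0 < 1 - x := sub_pos.2 hx.2
  have hy0 := hy.1
  have hx0 := hx.1
  have hE (t : ℝ) : HasDerivAt (fun t => aperyDenom (x, y, t)) (-(1 - x * y)) t := by
    convert! hasDerivAt_linear 1 (-(1 - x * y)) t using 1
    ext s
    simp only [aperyDenom]
    ring
  have hEpos : ∀ t ∈ Set.Icc (0 : ℝ) 1, 0 < aperyDenom (x, y, t) := by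
    intro t ht
    have hxy : x * y < 1 := mul_lt_one_of_nonneg_of_lt_one_left hx0.le hx.2 hy.2.le
    have : (1 - x * y) * t ≤ (1 - x * y) * 1 :=
      mul_le_mul_of_nonneg_left ht.2 (sub_nonneg.2 hxy.le)
    have := mul_pos hx0 hy0
    simp only [aperyDenom]
    linarith
  set k : ℝ := m + 1
  have ha : ∀ t ∈ Set.Icc (0 : ℝ) 1, HasDerivAt
      (fun t => certZ₀ k x y 0 + certZ₀ k x y 1 * t + (certZ₁ k x y 0 + certZ₁ k x y 1 * t) *
        aperyRatio (x, y, t)) _ t := fun t ht =>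
    (hasDerivAt_linear (certZ₀ k x y 0) (certZ₀ k x y 1) t).fun_add
      ((hasDerivAt_linear (certZ₁ k x y 0) (certZ₁ k x y 1) t).fun_mul
        (((hasDerivAt_id t).const_sub 1).fun_div (hE t) (hEpos t ht).ne'))
  have hK : 0 < x * (1 - x) * y * (1 - y) := by positivity
  rw [← integral_deriv_mul_weight_eq_zero m hK (fun t _ => hE t) hEpos ha]
  refine integral_congr_ae (ae_restrict_of_forall_mem measurableSet_Ioo fun t ht => ?_)
  have hd := (hEpos t (Set.Ioo_subset_Icc_self ht)).ne'
  have hU : t * (1 - t) * (x * (1 - x) * y * (1 - y)) = aperyNumer (x, y, t) := by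
    simp only [aperyNumer]
    ring
  have hk : (m : ℝ) + 1 / 2 = k - 1 / 2 := by
    simp only [k]
    ring
  simp only [hU, hk, divZ]
  rw [aperyWeight]
  congr 1
  simp only [aperyRatio, id]
  field_simp
  ring

/-- Fubini: integrals over the cube vanish if they vanish along the lines in one direction. -/
lemma integral_cube_eq_zero_of_fst {f : ℝ × ℝ × ℝ → ℝ} (hf : Integrable f cubeMeasure)
    (h : ∀ y ∈ Set.Ioo (0 : ℝ) 1, ∀ z ∈ Set.Ioo (0 : ℝ) 1, ∫ x, f (x, y, z) ∂unitMeasure = 0) :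
    ∫ p, f p ∂cubeMeasure = 0 := by
  rw [cubeMeasure, integral_prod_symm f hf]
  refine integral_eq_zero_of_ae ?_
  rw [unitMeasure, Measure.prod_restrict]
  refine ae_restrict_of_forall_mem (measurableSet_Ioo.prod measurableSet_Ioo) ?_
  rintro ⟨y, z⟩ ⟨hy, hz⟩
  exact h y hy z hz

lemma integral_cube_eq_zero_of_snd_fst {f : ℝ × ℝ × ℝ → ℝ} (hf : Integrable f cubeMeasure)
    (h : ∀ x ∈ Set.Ioo (0 : ℝ) 1, ∀ z ∈ Set.Ioo (0 : ℝ) 1, ∫ y, f (x, y, z) ∂unitMeasure = 0) :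
    ∫ p, f p ∂cubeMeasure = 0 := by
  rw [cubeMeasure, integral_prod f hf]
  refine integral_eq_zero_of_ae (ae_restrict_of_forall_mem measurableSet_Ioo fun x hx => ?_)
  by_cases hi : Integrable (fun w : ℝ × ℝ => f (x, w)) (unitMeasure.prod unitMeasure)
  · beta_reduce
    rw [integral_prod_symm _ hi]
    exact integral_eq_zero_of_ae (ae_restrict_of_forall_mem measurableSet_Ioo fun z hz => h x hx z hz)
  · exact integral_undef hi

lemma integral_cube_eq_zero_of_snd_snd {f : ℝ × ℝ × ℝ → ℝ} (hf : Integrable f cubeMeasure)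
    (h : ∀ x ∈ Set.Ioo (0 : ℝ) 1, ∀ y ∈ Set.Ioo (0 : ℝ) 1, ∫ z, f (x, y, z) ∂unitMeasure = 0) :
    ∫ p, f p ∂cubeMeasure = 0 := by
  rw [cubeMeasure, integral_prod f hf]
  refine integral_eq_zero_of_ae (ae_restrict_of_forall_mem measurableSet_Ioo fun x hx => ?_)
  by_cases hi : Integrable (fun w : ℝ × ℝ => f (x, w)) (unitMeasure.prod unitMeasure)
  · beta_reduce
    rw [integral_prod _ hi]
    exact integral_eq_zero_of_ae (ae_restrict_of_forall_mem measurableSet_Ioo fun y hy => h x hx y hy)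
  · exact integral_undef hi

lemma aperyWeight_swap (m : ℕ) (x y z : ℝ) : aperyWeight m (x, y, z) = aperyWeight m (y, x, z) := by
  have h1 : aperyNumer (x, y, z) = aperyNumer (y, x, z) := by
    simp only [aperyNumer]
    ring
  have h2 : aperyDenom (x, y, z) = aperyDenom (y, x, z) := by
    simp only [aperyDenom]
    ring
  rw [aperyWeight, aperyWeight, h1, h2]

lemma aperyRatio_swap (x y z : ℝ) : aperyRatio (x, y, z) = aperyRatio (y, x, z) := by
  simp only [aperyRatio, aperyDenom, mul_comm x y]

/-- Apéry's recurrence, with the index shifted by one half. -/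
theorem aperyIntegral_recurrence (m : ℕ) :
    (2 * (m + 1 : ℝ) + 1) ^ 3 * aperyIntegral (m + 2)
      - 4 * (m + 1 : ℝ) * (68 * (m + 1 : ℝ) ^ 2 + 3) * aperyIntegral (m + 1)
      + (2 * (m + 1 : ℝ) - 1) ^ 3 * aperyIntegral m = 0 := by
  have i₁ := integrable_aperyWeight_mul m (continuous_divX (m + 1))
  have i₂ := integrable_aperyWeight_mul m (g := fun v => divX (m + 1) v.2.1 v.1 v.2.2.1 v.2.2.2)
    ((continuous_divX (m + 1)).comp
      (f := fun v : ℝ × ℝ × ℝ × ℝ => (v.2.1, v.1, v.2.2.1, v.2.2.2)) (by fun_prop))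
  have i₃ := integrable_aperyWeight_mul m (continuous_divZ (m + 1))
  have h₁ := integral_cube_eq_zero_of_fst i₁ fun y hy z hz =>
    integral_aperyWeight_mul_divX_slice m hy hz
  have h₂ := integral_cube_eq_zero_of_snd_fst i₂ fun x hx z hz => by
    simp only [aperyWeight_swap m x, aperyRatio_swap x]
    exact integral_aperyWeight_mul_divX_slice m hx hz
  have h₃ := integral_cube_eq_zero_of_snd_snd i₃ fun x hx y hy =>
    integral_aperyWeight_mul_divZ_slice m hx hy
  have hsum := integral_add (i₁.add i₂) i₃
  simp only [Pi.add_apply] at hsum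
  rw [integral_add i₁ i₂, h₁, h₂, h₃] at hsum
  rw [← add_zero (0 : ℝ), ← add_zero (0 + 0 : ℝ), ← hsum]
  simp only [aperyIntegral]
  have j (c : ℝ) (n : ℕ) : Integrable (fun p => c * aperyWeight n p) cubeMeasure :=
    (integrable_aperyWeight n).const_mul c
  rw [← integral_const_mul, ← integral_const_mul, ← integral_const_mul,
    ← integral_sub (j _ _) (j _ _), ← integral_add (by exact (j _ _).sub (j _ _)) (j _ _)]
  refine integral_congr_ae (ae_cubeMeasure fun x hx y hy z hz => ?_)
  have h := divX_add_divX_add_divZ (k := m + 1) (aperyDenom_eq_add x y z)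
    (aperyDenom_pos hx hy hz).ne'
  have hW : x * (1 - x) * y * (1 - y) * z * ((1 - z) / aperyDenom (x, y, z)) =
      aperyNumer (x, y, z) / aperyDenom (x, y, z) := by
    simp only [aperyNumer]
    ring
  rw [hW] at h
  simp only [← mul_add]
  simp only [aperyRatio, h]
  simp only [aperyWeight, pow_succ]
  ring

/-! ### Asymptotics and the limit -/

lemma aperyIntegral_nonneg (m : ℕ) : 0 ≤ aperyIntegral m :=
  integral_nonneg_of_ae (ae_cubeMeasure fun _ hx _ hy _ hz => (aperyWeight_pos m hx hy hz).le)

lemma aperyIntegral_zero_pos : 0 < aperyIntegral 0 := by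
  have hnn : 0 ≤ᵐ[cubeMeasure] aperyWeight 0 :=
    ae_cubeMeasure fun _ hx _ hy _ hz => (aperyWeight_pos 0 hx hy hz).le
  rw [aperyIntegral, integral_pos_iff_support_of_nonneg_ae hnn integrable_aperyWeight_zero]
  refine lt_of_lt_of_le (b := cubeMeasure Set.univ) ?_ (measure_mono_ae ?_)
  · rw [cubeMeasure, unitMeasure]
    simp [← Set.univ_prod_univ, Measure.prod_prod]
  · refine ae_cubeMeasure fun x hx y hy z hz _ => ?_
    exact (aperyWeight_pos 0 hx hy hz).ne'

lemma tendsto_aperyIntegral : Tendsto aperyIntegral atTop (nhds 0) := by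
  have hle (m : ℕ) : aperyIntegral m ≤ (1 / 2) ^ m * aperyIntegral 0 := by
    simp only [aperyIntegral]
    rw [← integral_const_mul]
    exact integral_mono_ae (integrable_aperyWeight m) (integrable_aperyWeight_zero.const_mul _)
      (ae_cubeMeasure fun _ hx _ hy _ hz => aperyWeight_le m hx hy hz)
  have h := (tendsto_pow_atTop_nhds_zero_of_lt_one (r := (1 / 2 : ℝ)) (by norm_num)
    (by norm_num)).mul_const (aperyIntegral 0)
  rw [zero_mul] at h
  exact squeeze_zero aperyIntegral_nonneg hle h

lemma I₃zero_eq : I₃zero = aperyIntegral 0 := by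
  simp only [I₃zero, aperyIntegral, cubeMeasure_eq_restrict, aperyWeight, aperyNumer, aperyDenom,
    pow_zero, one_mul]

lemma I₃one_eq : I₃one = aperyIntegral 1 := by
  rw [I₃one, aperyIntegral, ← cubeMeasure_eq_restrict]
  refine integral_congr_ae (ae_cubeMeasure fun x hx y hy z hz => ?_)
  have hu := aperyNumer_pos hx hy hz
  have hd := aperyDenom_pos hx hy hz
  change aperyNumer (x, y, z) ^ ((1 : ℝ) / 2) * aperyDenom (x, y, z) ^ (-(3 : ℝ) / 2) =
    aperyWeight 1 (x, y, z)
  rw [aperyWeight]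
  generalize aperyNumer (x, y, z) = u at *
  generalize aperyDenom (x, y, z) = d at *
  have e : d ^ (-(3 : ℝ) / 2) = (d * Real.sqrt d)⁻¹ := by
    rw [Real.sqrt_eq_rpow, ← Real.rpow_one_add' hd.le (by norm_num), ← Real.rpow_neg hd.le]
    norm_num
  rw [e, ← Real.sqrt_eq_rpow, Real.sqrt_mul hu.le]
  have hu' := Real.sqrt_pos.2 hu
  have hd' := Real.sqrt_pos.2 hd
  have := Real.sq_sqrt hu.le
  field_simp
  rw [this]

/-- The cube of the odd double factorial `(2n-1)!!`. -/
noncomputable def oddFactorialCube (n : ℕ) : ℝ := ∏ i ∈ Finset.range n, (2 * (i : ℝ) + 1) ^ 3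

lemma oddFactorialCube_succ (n : ℕ) :
    oddFactorialCube (n + 1) = oddFactorialCube n * (2 * (n : ℝ) + 1) ^ 3 :=
  Finset.prod_range_succ _ _

lemma oddFactorialCube_pos (n : ℕ) : 0 < oddFactorialCube n :=
  Finset.prod_pos fun i _ => by positivity

section Recurrence

variable {u : ℕ → ℝ}

/-- The recurrence, with the index shifted so that no natural subtraction occurs. -/
lemma recurrence_add_two
    (hu : ∀ n : ℕ, 2 ≤ n →
      u n = 4 * (n : ℝ) * (68 * (n : ℝ) ^ 2 + 3) * u (n - 1)
              - (2 * (n : ℝ) - 1) ^ 6 * u (n - 2)) (n : ℕ) :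
    u (n + 2) = 4 * (n + 2 : ℝ) * (68 * (n + 2 : ℝ) ^ 2 + 3) * u (n + 1)
      - (2 * (n : ℝ) + 3) ^ 6 * u n := by
  have h := hu (n + 2) (by omega)
  rw [show n + 2 - 1 = n + 1 by omega, Nat.add_sub_cancel] at h
  rw [h]
  push_cast
  ring

lemma oddFactorialCube_le
    (hu : ∀ n : ℕ, u (n + 2) = 4 * (n + 2 : ℝ) * (68 * (n + 2 : ℝ) ^ 2 + 3) * u (n + 1)
      - (2 * (n : ℝ) + 3) ^ 6 * u n) (h0 : u 0 = 1) (h1 : u 1 = 284) (n : ℕ) :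
    oddFactorialCube (n + 1) ≤ u n ∧ (2 * (n : ℝ) + 3) ^ 3 * u n ≤ u (n + 1) := by
  induction n with
  | zero =>
    norm_num [oddFactorialCube, h0, h1]
  | succ n ih =>
    obtain ⟨ih1, ih2⟩ := ih
    have hc : oddFactorialCube (n + 1 + 1) ≤ u (n + 1) := by
      refine le_trans ?_ ih2
      rw [oddFactorialCube_succ, mul_comm]
      push_cast
      rw [show 2 * ((n : ℝ) + 1) + 1 = 2 * n + 3 by ring]
      gcongr
    refine ⟨hc, ?_⟩
    have hpos : 0 ≤ u (n + 1) := (oddFactorialCube_pos _).le.trans hc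
    have hmul : (2 * (n : ℝ) + 3) ^ 6 * u n ≤ (2 * (n : ℝ) + 3) ^ 3 * u (n + 1) := by
      calc (2 * (n : ℝ) + 3) ^ 6 * u n
          = (2 * (n : ℝ) + 3) ^ 3 * ((2 * (n : ℝ) + 3) ^ 3 * u n) := by ring
        _ ≤ _ := by gcongr
    have hcoef : 0 ≤ 4 * (n + 2 : ℝ) * (68 * (n + 2 : ℝ) ^ 2 + 3) - (2 * (n : ℝ) + 3) ^ 3
        - (2 * (n : ℝ) + 5) ^ 3 := by
      ring_nf
      positivity
    have := mul_nonneg hcoef hpos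
    rw [hu n]
    push_cast
    rw [show 2 * ((n : ℝ) + 1) + 3 = 2 * n + 5 by ring]
    linarith

/-- A sequence satisfying the recurrence whose first two values agree with the rescaled integrals
is the sequence of rescaled integrals. -/
lemma eq_oddFactorialCube_mul_aperyIntegral
    (hu : ∀ n : ℕ, u (n + 2) = 4 * (n + 2 : ℝ) * (68 * (n + 2 : ℝ) ^ 2 + 3) * u (n + 1)
      - (2 * (n : ℝ) + 3) ^ 6 * u n) (h0 : u 0 = aperyIntegral 1)
    (h1 : u 1 = 284 * aperyIntegral 1 - aperyIntegral 0) (n : ℕ) :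
    u n = oddFactorialCube (n + 1) * aperyIntegral (n + 1) := by
  induction n using Nat.twoStepInduction with
  | zero => simp [oddFactorialCube, h0]
  | one =>
    have h := aperyIntegral_recurrence 0
    norm_num at h
    norm_num [oddFactorialCube, Finset.prod_range_succ, h1]
    linarith
  | more n ih0 ih1 =>
    have h := aperyIntegral_recurrence (n + 1)
    rw [hu n, ih0, ih1, oddFactorialCube_succ (n + 1 + 1), oddFactorialCube_succ (n + 1)]
    push_cast at h ⊢
    linear_combination -oddFactorialCube (n + 1) * (2 * (n : ℝ) + 3) ^ 3 * h

end Recurrence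

/-- The continued fraction `[[112,4n(68n²+3)],[16,-(2n+1)⁶]]` converges to
`112 + 16·I₃(1)/I₃(0)` (which is `-3η₊/ω₊`). -/
theorem shifted_big_apery (p q : ℕ → ℝ)
    (hp : ∀ n : ℕ, 2 ≤ n →
      p n = 4 * (n : ℝ) * (68 * (n : ℝ) ^ 2 + 3) * p (n - 1)
              - (2 * (n : ℝ) - 1) ^ 6 * p (n - 2))
    (hq : ∀ n : ℕ, 2 ≤ n →
      q n = 4 * (n : ℝ) * (68 * (n : ℝ) ^ 2 + 3) * q (n - 1)
              - (2 * (n : ℝ) - 1) ^ 6 * q (n - 2))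
    (hp0 : p 0 = 112) (hp1 : p 1 = 31824) (hq0 : q 0 = 1) (hq1 : q 1 = 284) :
    (∀ n, q n ≠ 0) ∧
    Tendsto (fun n => p n / q n) atTop (nhds (112 + 16 * I₃one / I₃zero)) := by
  have hp' := recurrence_add_two hp
  have hq' := recurrence_add_two hq
  have hle (n : ℕ) := (oddFactorialCube_le hq' hq0 hq1 n).1
  have hqpos (n : ℕ) : 0 < q n := (oddFactorialCube_pos _).trans_le (hle n)
  refine ⟨fun n => (hqpos n).ne', ?_⟩
  rw [I₃zero_eq, I₃one_eq]
  have hI := aperyIntegral_zero_pos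
  have hr (n : ℕ) : aperyIntegral 1 * q n - aperyIntegral 0 * (p n - 112 * q n) / 16 =
      oddFactorialCube (n + 1) * aperyIntegral (n + 1) := by
    refine eq_oddFactorialCube_mul_aperyIntegral
      (u := fun n => aperyIntegral 1 * q n - aperyIntegral 0 * (p n - 112 * q n) / 16)
      (fun n => ?_) ?_ ?_ n
    · simp only [hp' n, hq' n]
      ring
    · simp only [hp0, hq0]
      ring
    · simp only [hp1, hq1]
      ring
  have hform (n : ℕ) : p n / q n = 112 + 16 * aperyIntegral 1 / aperyIntegral 0 -
      16 / aperyIntegral 0 * (oddFactorialCube (n + 1) / q n * aperyIntegral (n + 1)) := by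
    have := (hqpos n).ne'
    field_simp
    linear_combination -16 * hr n
  have hlim : Tendsto (fun n => oddFactorialCube (n + 1) / q n * aperyIntegral (n + 1))
      atTop (nhds 0) := by
    refine squeeze_zero (fun n => ?_) (fun n => ?_)
      (tendsto_aperyIntegral.comp (tendsto_add_atTop_nat 1))
    · exact mul_nonneg (div_nonneg (oddFactorialCube_pos _).le (hqpos n).le)
        (aperyIntegral_nonneg _)
    · exact mul_le_of_le_one_left (aperyIntegral_nonneg _)
        (div_le_one_of_le₀ (hle n) (hqpos n).le)
  simpa [hform] using (hlim.const_mul (16 / aperyIntegral 0)).const_sub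
    (112 + 16 * aperyIntegral 1 / aperyIntegral 0)
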